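/- There is an absolute constant C with the following property. Let {a_s}_{s=1}^N be nonnegative integers and for each s let Θ_s ⊆ {1, 2, 3, …} be a finite set, such that the sets {a_s ∔ δ_j : 1 ≤ s ≤ N, j ∈ Θ_s ∪ {0}} are pairwise disjoint. For g = (g_s)_{s=1}^N with each g_s ∈ L^1[0,1], define T*g = Σ_{s=1}^N w_{a_s} Σ_{j ∈ Θ_s ∪ {0}} Δ_j g_s. Then for every λ > 0: |{x ∈ [0,1] : |T*g(x)| > λ}| ≤ C λ^{−1} ∫_0^1 ( Σ_{s=1}^N |g_s(x)|² )^{1/2} dx, where C does not depend on N, the family {a_s}, the sets Θ_s, or g. -/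

import Mathlib

open MeasureTheory Real
open scoped ENNReal NNReal RealInnerProductSpace

noncomputable section

/-- The Lebesgue measure restricted to `[0,1)`. -/
def μ01 : MeasureTheory.Measure ℝ := MeasureTheory.volume.restrict (Set.Ico (0:ℝ) 1)

/-- The `k`-th Rademacher function `r_k(x) = sign (sin (2^k π x))`. -/
def rademacher (k : ℕ) (x : ℝ) : ℝ := Real.sign (Real.sin (2 ^ k * Real.pi * x))

/-- The `n`-th Walsh function: the product of `r_{k+1}` over the binary digits `k` of `n`
(so that `w_0 ≡ 1`). -/
def walsh (n : ℕ) (x : ℝ) : ℝ :=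
  ∏ k ∈ Finset.range (n + 1), if n.testBit k then rademacher (k + 1) x else 1

/-- The `n`-th Walsh coefficient `(f, w_n) = ∫_0^1 f w_n`. -/
def walshCoeff (f : ℝ → ℝ) (n : ℕ) : ℝ := ∫ x in Set.Ico (0:ℝ) 1, f x * walsh n x

/-- The Walsh spectral projection `P_A f = Σ_{n ∈ A} (f, w_n) w_n`. -/
def walshProj (A : Set ℕ) (f : ℝ → ℝ) (x : ℝ) : ℝ :=
  ∑' n : ℕ, Set.indicator A (fun m => walshCoeff f m * walsh m x) n

/-- The dyadic σ-algebra `F_k`, generated by the intervals `[i 2^{-k}, (i+1) 2^{-k})`. -/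
def dyadicSigma (k : ℕ) : MeasurableSpace ℝ :=
  MeasurableSpace.comap (fun x : ℝ => ⌊x * 2 ^ k⌋) ⊤

variable {E : Type*} [NormedAddCommGroup E] [NormedSpace ℝ E] [CompleteSpace E]

/-- `E_k f`, the conditional expectation of `f` with respect to `F_k` (over `[0,1)`). -/
def Ek (k : ℕ) (f : ℝ → E) : ℝ → E := μ01[f | dyadicSigma k]

/-- The martingale difference `Δ_k f = E_k f - E_{k-1} f` for `k ≥ 1`;
`Δ_0 f` is the constant `∫_0^1 f`. -/
def Dk (k : ℕ) (f : ℝ → E) : ℝ → E :=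
  if k = 0 then fun _ => ∫ x in Set.Ico (0:ℝ) 1, f x else Ek k f - Ek (k - 1) f

/-- `δ_k`: `δ_0 = {0}`, and `δ_k = {n : 2^{k-1} ≤ n ≤ 2^k - 1}` for `k ≥ 1`. -/
def deltaSet : ℕ → Set ℕ
  | 0 => {0}
  | (k + 1) => Set.Icc (2 ^ k) (2 ^ (k + 1) - 1)

/-- The dyadic interval `[i 2^{-k}, (i+1) 2^{-k})`. -/
def dyadicI (k i : ℕ) : Set ℝ := Set.Ico ((i : ℝ) / 2 ^ k) ((i + 1 : ℝ) / 2 ^ k)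

/-- The dyadic sharp maximal function
`g^#(x) = sup_{I ∋ x} (|I|⁻¹ ∫_I ‖g - g_I‖² )^{1/2}`, the supremum being taken over
dyadic intervals `I` containing `x`, and `g_I = |I|⁻¹ ∫_I g`. -/
def dyadicSharp (g : ℝ → E) (x : ℝ) : ℝ :=
  ⨆ q : {q : ℕ × ℕ // q.2 < 2 ^ q.1 ∧ x ∈ dyadicI q.1 q.2},
    Real.sqrt ((2:ℝ) ^ q.1.1 * ∫ t in dyadicI q.1.1 q.1.2,
      ‖g t - (2:ℝ) ^ q.1.1 • ∫ u in dyadicI q.1.1 q.1.2, g u‖ ^ 2)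

/-- The dyadic maximal function `M₂ f(x) = sup_{I ∋ x} (|I|⁻¹ ∫_I |f|²)^{1/2}`,
the supremum being taken over dyadic intervals `I` containing `x`. -/
def M2 (f : ℝ → ℝ) (x : ℝ) : ℝ :=
  ⨆ q : {q : ℕ × ℕ // q.2 < 2 ^ q.1 ∧ x ∈ dyadicI q.1 q.2},
    Real.sqrt ((2:ℝ) ^ q.1.1 * ∫ t in dyadicI q.1.1 q.1.2, f t ^ 2)

/-- The dyadic martingale square function of an `ℓ²`-valued function. -/
def sqFun (u : ℝ → lp (fun _ : ℕ => ℝ) 2) (x : ℝ) : ℝ :=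
  Real.sqrt (∑' j : ℕ, ‖Dk j u x‖ ^ 2)

end
section
variable {Ω : Type*}

/-- A dyadic martingale: `F k` is invariant under the flips `σ i` of the digits `k ≤ i < K`, and is
the average of `F (k + 1)` over the orbits of `σ k`. -/
structure IsDyadicMartingale (σ : ℕ → Ω → Ω) (K : ℕ) (F : ℕ → Ω → ℝ) : Prop where
  invariant : ∀ k i x, k ≤ i → i < K → F k (σ i x) = F k x
  average : ∀ k x, k < K → F (k + 1) x + F (k + 1) (σ k x) = 2 * F k x

/-- The differences `F 0, F 1 - F 0, F 2 - F 1, …`. -/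
def martingaleDiff (F : ℕ → Ω → ℝ) : ℕ → Ω → ℝ
  | 0 => F 0
  | j + 1 => F (j + 1) - F j

open Classical in
/-- The indicator that `M` has not exceeded `lam` before time `j`. -/
noncomputable def cutoff (M : ℕ → Ω → ℝ) (lam : ℝ) (j : ℕ) (x : Ω) : ℝ :=
  if ∀ i ≤ j - 1, M i x ≤ lam then 1 else 0

/-- The process `V` stopped when `M` exceeds `lam`, with initial value `V₀`. -/
noncomputable def stopped (M : ℕ → Ω → ℝ) (lam : ℝ) (V : ℕ → Ω → ℝ) (V₀ : Ω → ℝ) : ℕ → Ω → ℝ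
  | 0 => V₀
  | k + 1 => fun x => stopped M lam V V₀ k x + cutoff M lam (k + 1) x * (V (k + 1) x - V k x)

theorem sum_eq_zero_of_odd [Fintype Ω] {τ : Ω → Ω} (hτ : Function.Involutive τ) {f : Ω → ℝ}
    (hf : ∀ x, f (τ x) = -f x) : ∑ x, f x = 0 := by
  have h := Equiv.sum_comp hτ.toPerm f
  simp only [Function.Involutive.coe_toPerm, hf, Finset.sum_neg_distrib] at h
  linarith

variable {σ : ℕ → Ω → Ω} {K : ℕ} {F M : ℕ → Ω → ℝ} {lam : ℝ}

theorem IsDyadicMartingale.diff_odd (hF : IsDyadicMartingale σ K F) {j : ℕ} (hj : j < K) (x : Ω) :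
    martingaleDiff F (j + 1) (σ j x) = -martingaleDiff F (j + 1) x := by
  have h1 := hF.average j x hj
  have h2 := hF.invariant j j x le_rfl hj
  simp only [martingaleDiff, Pi.sub_apply]
  linarith

theorem IsDyadicMartingale.diff_invariant (hF : IsDyadicMartingale σ K F) {j i : ℕ} (hji : j ≤ i)
    (hi : i < K) (x : Ω) : martingaleDiff F j (σ i x) = martingaleDiff F j x := by
  cases j with
  | zero => exact hF.invariant 0 i x hji hi
  | succ j =>
    simp only [martingaleDiff, Pi.sub_apply]
    rw [hF.invariant _ i x hji hi, hF.invariant _ i x (by omega) hi]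

theorem cutoff_invariant (hM : IsDyadicMartingale σ K M) {j i : ℕ} (hji : j ≤ i + 1)
    (hi : i < K) (x : Ω) : cutoff M lam j (σ i x) = cutoff M lam j x := by
  have h : (∀ i' ≤ j - 1, M i' (σ i x) ≤ lam) ↔ ∀ i' ≤ j - 1, M i' x ≤ lam :=
    forall₂_congr fun i' hi' => by rw [hM.invariant i' i x (by omega) hi]
  simp only [cutoff, h]

theorem cutoff_succ_eq_one_iff {j : ℕ} {x : Ω} :
    cutoff M lam (j + 1) x = 1 ↔ ∀ i ≤ j, M i x ≤ lam := by
  simp [cutoff]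

theorem cutoff_eq_zero_or_one (j : ℕ) (x : Ω) :
    cutoff M lam j x = 0 ∨ cutoff M lam j x = 1 := by
  unfold cutoff; split_ifs <;> simp

theorem cutoff_eq_zero_of_le {j k : ℕ} (hjk : j ≤ k) {x : Ω} (h : cutoff M lam j x = 0) :
    cutoff M lam k x = 0 := by
  unfold cutoff at *
  rw [ite_eq_right_iff] at h ⊢
  exact fun hk => h fun i hi => hk i (by omega)

theorem cutoff_mul_diff_flip (hF : IsDyadicMartingale σ K F) (hM : IsDyadicMartingale σ K M)
    {j m : ℕ} (hj : j ≤ m + 1) (hm : m < K) (x : Ω) :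
    cutoff M lam j (σ m x) * martingaleDiff F j (σ m x) =
      (if j = m + 1 then -1 else 1) * (cutoff M lam j x * martingaleDiff F j x) := by
  rw [cutoff_invariant hM hj hm]
  split_ifs with h
  · subst h
    rw [hF.diff_odd hm]; ring
  · rw [hF.diff_invariant (by omega) hm]; ring

theorem stopped_spec {V : ℕ → Ω → ℝ} (hM : IsDyadicMartingale σ K M) (hM0 : ∀ k x, 0 ≤ M k x)
    (hV : ∀ k x, V k x ≤ M k x ^ 2) (hlam : 0 < lam) (x : Ω) {k : ℕ} (hk : k ≤ K) :
    stopped M lam V (fun x => cutoff M lam 0 x * V 0 x) k x ≤ 2 * lam * stopped M lam M (M 0) k x ∧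
    (cutoff M lam (k + 1) x = 1 →
      stopped M lam V (fun x => cutoff M lam 0 x * V 0 x) k x = V k x ∧
      stopped M lam M (M 0) k x = M k x) ∧
    (cutoff M lam (k + 1) x = 0 → lam < stopped M lam M (M 0) k x) := by
  induction k with
  | zero =>
    have h01 : cutoff M lam 0 x = cutoff M lam (0 + 1) x := rfl
    have h1 := hM0 0 x
    have h2 := hV 0 x
    simp only [stopped, h01]
    have hiff := cutoff_succ_eq_one_iff (M := M) (lam := lam) (j := 0) (x := x)
    rcases cutoff_eq_zero_or_one (M := M) (lam := lam) (0 + 1) x with h | h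
    · rw [h] at hiff ⊢
      have : lam < M 0 x := by
        by_contra hcon
        exact zero_ne_one (hiff.2 (by intro i hi; obtain rfl : i = 0 := by omega
                                      exact not_lt.1 hcon))
      refine ⟨by simp; positivity, by simp, fun _ => this⟩
    · have := hiff.1 h 0 le_rfl
      rw [h]
      refine ⟨by nlinarith, by simp, by simp⟩
  | succ k ih =>
    obtain ⟨ih1, ih2, ih3⟩ := ih (by omega)
    simp only [stopped]
    rcases cutoff_eq_zero_or_one (M := M) (lam := lam) (k + 1) x with h | h
    · have h' := cutoff_eq_zero_of_le (k := k + 1 + 1) (by omega) h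
      rw [h, h']
      refine ⟨by simpa using ih1, by simp, fun _ => by simpa using ih3 h⟩
    · obtain ⟨e1, e2⟩ := ih2 h
      rw [e1, e2, h]
      have hk1 := cutoff_succ_eq_one_iff.1 h
      have hd := hM.average k x (by omega)
      have hp := hM0 (k + 1) (σ k x)
      have hp' := hM0 (k + 1) x
      have hle := hk1 k le_rfl
      have hv := hV (k + 1) x
      refine ⟨by nlinarith, by simp, fun h0 => ?_⟩
      by_contra hcon
      have : cutoff M lam (k + 1 + 1) x = 1 := cutoff_succ_eq_one_iff.2 fun i hi => by
        rcases Nat.lt_or_ge i (k + 1) with hlt | hge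
        · exact hk1 i (by omega)
        · obtain rfl : i = k + 1 := by omega
          linarith
      rw [h0] at this
      exact zero_ne_one this

theorem sum_stopped_self [Fintype Ω] (hσ : ∀ i, Function.Involutive (σ i))
    (hM : IsDyadicMartingale σ K M) {k : ℕ} (hk : k ≤ K) :
    ∑ x, stopped M lam M (M 0) k x = ∑ x, M 0 x := by
  induction k with
  | zero => rfl
  | succ k ih =>
    simp only [stopped, Finset.sum_add_distrib, ih (by omega)]
    rw [add_eq_left]
    refine sum_eq_zero_of_odd (hσ k) fun x => ?_
    have := cutoff_mul_diff_flip (lam := lam) hM hM (j := k + 1) le_rfl (by omega : k < K) x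
    simpa [martingaleDiff] using this

theorem sum_stopped_sq [Fintype Ω] {ι : Type*} [Fintype ι] {F : ι → ℕ → Ω → ℝ}
    (hσ : ∀ i, Function.Involutive (σ i)) (hF : ∀ s, IsDyadicMartingale σ K (F s))
    (hM : IsDyadicMartingale σ K M) {k : ℕ} (hk : k ≤ K) :
    ∑ x, stopped M lam (fun k x => ∑ s, F s k x ^ 2)
      (fun x => cutoff M lam 0 x * ∑ s, F s 0 x ^ 2) k x =
      ∑ s, ∑ j ∈ Finset.range (k + 1), ∑ x,
        (cutoff M lam j x * martingaleDiff (F s) j x) ^ 2 := by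
  have hsq : ∀ j x, cutoff M lam j x ^ 2 = cutoff M lam j x := fun j x => by
    rcases cutoff_eq_zero_or_one (M := M) (lam := lam) j x with h | h <;> simp [h]
  induction k with
  | zero =>
    simp only [stopped, zero_add, Finset.range_one, Finset.sum_singleton, mul_pow, hsq,
      martingaleDiff, Finset.mul_sum]
    exact Finset.sum_comm
  | succ k ih =>
    simp only [stopped, Finset.sum_add_distrib, ih (by omega), Finset.sum_range_succ _ (k + 1)]
    congr 1
    simp only [← Finset.sum_sub_distrib, Finset.mul_sum]
    rw [Finset.sum_comm]
    refine Finset.sum_congr rfl fun s _ => ?_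
    rw [← sub_eq_zero, ← Finset.sum_sub_distrib]
    refine sum_eq_zero_of_odd (hσ k) fun x => ?_
    have h1 := cutoff_invariant (lam := lam) hM (le_refl (k + 1)) (by omega : k < K) x
    have h2 := (hF s).invariant k k x le_rfl (by omega)
    have h3 := (hF s).average k x (by omega)
    have h4 : F s (k + 1) (σ k x) = 2 * F s k x - F s (k + 1) x := by linarith
    simp only [martingaleDiff, Pi.sub_apply, mul_pow, hsq]
    rw [h1, h2, h4]
    ring

/-- Weak type `(1,1)` for a transform of dyadic martingales whose components are orthogonal: stop
the martingales when the majorant `M` exceeds `lam` and use orthogonality in `L²`. -/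
theorem card_mul_le_of_orthogonal [Fintype Ω] {ι : Type*} [Fintype ι]
    {F : ι → ℕ → Ω → ℝ} {W : ι → Ω → ℝ} {Θ : ι → Finset ℕ} {ε : ι → ℕ → ℝ}
    (hσ : ∀ i, Function.Involutive (σ i)) (hF : ∀ s, IsDyadicMartingale σ K (F s))
    (hM : IsDyadicMartingale σ K M) (hM0 : ∀ k x, 0 ≤ M k x)
    (hFM : ∀ k x, ∑ s, F s k x ^ 2 ≤ M k x ^ 2)
    (hW : ∀ s x, W s x ^ 2 ≤ 1)
    (hWσ : ∀ s i x, i < K → W s (σ i x) = ε s i * W s x)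
    (hΘ : ∀ s, ∀ j ∈ Θ s, j ≤ K)
    (hsep : ∀ s s' j j', j ∈ Θ s → j' ∈ Θ s' → (s, j) ≠ (s', j') → ∃ m < K, j ≤ m + 1 ∧
      j' ≤ m + 1 ∧ ε s m * ε s' m * (if j = m + 1 then -1 else 1) *
        (if j' = m + 1 then -1 else 1) = -1)
    (hlam : 0 < lam) :
    (Finset.univ.filter fun x => lam < |∑ s, W s x * ∑ j ∈ Θ s, martingaleDiff (F s) j x|).card
      * lam ≤ 3 * ∑ x, M 0 x := by
  classical
  set D : ι → ℕ → Ω → ℝ := fun s j x => cutoff M lam j x * martingaleDiff (F s) j x with hD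
  set Z := stopped M lam M (M 0) K
  set T : Ω → ℝ := fun x => ∑ s, W s x * ∑ j ∈ Θ s, D s j x
  have hl2 : ∑ x, T x ^ 2 ≤ 2 * lam * ∑ x, Z x := by
    set P := Finset.univ.sigma Θ
    have hT : ∀ x, T x = ∑ p ∈ P, W p.1 x * D p.1 p.2 x := fun x => by
      simp only [T, P, Finset.sum_sigma, Finset.mul_sum]
    have hdiag : ∑ x, T x ^ 2 = ∑ p ∈ P, ∑ x, (W p.1 x * D p.1 p.2 x) ^ 2 := by
      simp only [hT, sq, Finset.sum_mul_sum]
      rw [Finset.sum_comm]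
      refine Finset.sum_congr rfl fun p hp => ?_
      rw [Finset.sum_comm]
      refine Finset.sum_eq_single_of_mem p hp fun q hq hqp => ?_
      obtain ⟨s, j⟩ := p
      obtain ⟨s', j'⟩ := q
      simp only [P, Finset.mem_sigma, Finset.mem_univ, true_and] at hp hq
      obtain ⟨m, hm, h1, h2, h3⟩ := hsep s s' j j' hp hq (by
        rintro h; simp only [Prod.mk.injEq] at h; obtain ⟨rfl, rfl⟩ := h; exact hqp rfl)
      refine sum_eq_zero_of_odd (hσ m) fun x => ?_
      simp only [hD, hWσ _ m x hm, cutoff_mul_diff_flip (hF _) hM h1 hm,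
        cutoff_mul_diff_flip (hF _) hM h2 hm]
      linear_combination (W s x * (cutoff M lam j x * martingaleDiff (F s) j x) *
        (W s' x * (cutoff M lam j' x * martingaleDiff (F s') j' x))) * h3
    rw [hdiag, Finset.sum_sigma]
    calc ∑ s, ∑ j ∈ Θ s, ∑ x, (W s x * D s j x) ^ 2
        ≤ ∑ s, ∑ j ∈ Finset.range (K + 1), ∑ x, D s j x ^ 2 := by
          refine Finset.sum_le_sum fun s _ => ?_
          refine (Finset.sum_le_sum fun j _ => Finset.sum_le_sum fun x _ => ?_).trans
            (Finset.sum_le_sum_of_subset_of_nonneg (f := fun j => ∑ x, D s j x ^ 2) ?_ ?_)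
          · rw [mul_pow]
            exact mul_le_of_le_one_left (sq_nonneg _) (hW s x)
          · intro j hj
            exact Finset.mem_range.2 (Nat.lt_succ_of_le (hΘ s j hj))
          · intros; positivity
      _ ≤ 2 * lam * ∑ x, Z x := by
          rw [← sum_stopped_sq hσ hF hM le_rfl, Finset.mul_sum]
          exact Finset.sum_le_sum fun x _ => (stopped_spec hM hM0 hFM hlam x le_rfl).1
  have hZ : ∑ x, Z x = ∑ x, M 0 x := sum_stopped_self hσ hM le_rfl
  have hZ0 : ∀ x, 0 ≤ Z x := fun x => by
    obtain ⟨-, h2, h3⟩ := stopped_spec hM hM0 hFM hlam x le_rfl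
    rcases cutoff_eq_zero_or_one (M := M) (lam := lam) (K + 1) x with h | h
    · exact (hlam.trans (h3 h)).le
    · exact (hM0 K x).trans_eq (h2 h).2.symm
  have hpt : ∀ x, lam < |∑ s, W s x * ∑ j ∈ Θ s, martingaleDiff (F s) j x| →
      lam ≤ Z x + T x ^ 2 / lam := fun x hx => by
    obtain ⟨-, h2, h3⟩ := stopped_spec hM hM0 hFM hlam x le_rfl
    rcases cutoff_eq_zero_or_one (M := M) (lam := lam) (K + 1) x with h | h
    · have : 0 ≤ T x ^ 2 / lam := by positivity
      linarith [h3 h]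
    · have hTx : T x = ∑ s, W s x * ∑ j ∈ Θ s, martingaleDiff (F s) j x := by
        refine Finset.sum_congr rfl fun s _ => congrArg _ (Finset.sum_congr rfl fun j hj => ?_)
        rcases cutoff_eq_zero_or_one (M := M) (lam := lam) j x with h0 | h0
        · rw [cutoff_eq_zero_of_le ((hΘ s j hj).trans (Nat.le_succ K)) h0] at h
          exact absurd h zero_ne_one
        · simp [hD, h0]
      rw [← hTx] at hx
      have : lam ≤ T x ^ 2 / lam := by
        rw [le_div_iff₀ hlam, ← sq_abs (T x)]
        nlinarith
      linarith [hZ0 x]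
  calc _ = ∑ x ∈ Finset.univ.filter
          fun x => lam < |∑ s, W s x * ∑ j ∈ Θ s, martingaleDiff (F s) j x|, lam := by simp
    _ ≤ ∑ x ∈ Finset.univ.filter
          fun x => lam < |∑ s, W s x * ∑ j ∈ Θ s, martingaleDiff (F s) j x|,
          (Z x + T x ^ 2 / lam) :=
        Finset.sum_le_sum fun x hx => hpt x (Finset.mem_filter.1 hx).2
    _ ≤ ∑ x, (Z x + T x ^ 2 / lam) :=
        Finset.sum_le_sum_of_subset_of_nonneg (Finset.filter_subset _ _) fun x _ _ =>
          add_nonneg (hZ0 x) (by positivity)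
    _ = ∑ x, Z x + (∑ x, T x ^ 2) / lam := by rw [Finset.sum_add_distrib, Finset.sum_div]
    _ ≤ ∑ x, Z x + 2 * ∑ x, Z x := by
        gcongr
        rw [div_le_iff₀ hlam]
        linarith
    _ = 3 * ∑ x, M 0 x := by rw [hZ]; ring
end

noncomputable section

theorem mem_deltaSet_succ {k n : ℕ} : n ∈ deltaSet (k + 1) ↔ n < 2 ^ (k + 1) ∧ n.testBit k := by
  have hpos : 0 < 2 ^ (k + 1) := by positivity
  simp only [deltaSet, Set.mem_Icc]
  constructor
  · rintro ⟨h1, h2⟩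
    exact ⟨by omega, Nat.testBit_of_two_pow_le_and_two_pow_add_one_gt h1 (by omega)⟩
  · rintro ⟨h1, h2⟩
    exact ⟨Nat.ge_two_pow_of_testBit h2, by omega⟩

theorem lt_two_pow_of_mem_deltaSet {k n : ℕ} (h : n ∈ deltaSet k) : n < 2 ^ k := by
  cases k with
  | zero => simpa [deltaSet] using h
  | succ k => exact (mem_deltaSet_succ.1 h).1

theorem deltaSet_nonempty (k : ℕ) : (deltaSet k).Nonempty := by
  cases k with
  | zero => exact ⟨0, rfl⟩
  | succ k =>
    exact ⟨2 ^ k, mem_deltaSet_succ.2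
      ⟨Nat.pow_lt_pow_right (by norm_num) (Nat.lt_succ_self k), Nat.testBit_two_pow_self⟩⟩

/-- The sign by which `w_a` changes under the flip of digit `i`. -/
def flipSign (a i : ℕ) : ℝ := if a.testBit i then -1 else 1

theorem exists_odd_flip {a b j i K : ℕ} (hj : j ≤ K) (hi : i ≤ K) (ha : a < 2 ^ K)
    (hb : b < 2 ^ K) (hab : Disjoint ((fun n => a ^^^ n) '' deltaSet j)
      ((fun n => b ^^^ n) '' deltaSet i)) :
    ∃ m < K, j ≤ m + 1 ∧ i ≤ m + 1 ∧ flipSign a m * flipSign b m *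
      (if j = m + 1 then -1 else 1) * (if i = m + 1 then -1 else 1) = -1 := by
  have hsep : ∀ n ∈ deltaSet j, ∀ n' ∈ deltaSet i, a ^^^ b ≠ n ^^^ n' := by
    intro n hn n' hn' h
    refine Set.disjoint_left.1 hab ⟨n, hn, rfl⟩ ⟨n', hn', ?_⟩
    have h' : b ^^^ n' = a ^^^ (a ^^^ b) ^^^ n' := by simp
    simp only [h', h]
    simp [Nat.xor_assoc]
  set c := a ^^^ b with hc
  have hcK : c < 2 ^ K := Nat.xor_lt_two_pow ha hb
  have hl : c.size ≤ K := Nat.size_le.2 hcK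
  obtain ⟨t, ht⟩ : ∃ t, t = max c.size (max j i) := ⟨_, rfl⟩
  cases t with
  | zero =>
    have h0 : c = 0 := Nat.size_eq_zero.1 (by omega)
    obtain rfl : j = 0 := by omega
    obtain rfl : i = 0 := by omega
    exact absurd h0 (hsep 0 rfl 0 rfl)
  | succ m =>
    have hcm : c < 2 ^ (m + 1) := Nat.size_le.1 (by omega)
    have hsz : c.size = m + 1 → c.testBit m = true := fun h =>
      Nat.testBit_of_two_pow_le_and_two_pow_add_one_gt
        (Nat.lt_size.1 (by omega)) hcm
    have hbits : c.testBit m = (a.testBit m ^^ b.testBit m) := by rw [hc, Nat.testBit_xor]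
    have hpow : ∀ {d}, d < m + 1 → 2 ^ d ≤ 2 ^ m := fun h =>
      Nat.pow_le_pow_right (by norm_num) (by omega)
    refine ⟨m, by omega, by omega, by omega, ?_⟩
    have hsign : flipSign a m * flipSign b m = if c.testBit m then -1 else 1 := by
      rw [hbits, flipSign, flipSign]
      cases a.testBit m <;> cases b.testBit m <;> simp
    rw [hsign]
    by_cases hjm : j = m + 1 <;> by_cases him : i = m + 1
    · have : c.testBit m = true := by
        by_contra hcon
        subst hjm
        have h2 : (2 : ℕ) ^ m ∈ deltaSet (m + 1) := mem_deltaSet_succ.2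
          ⟨Nat.pow_lt_pow_right (by norm_num) (Nat.lt_succ_self m), Nat.testBit_two_pow_self⟩
        refine hsep (2 ^ m) h2 (2 ^ m ^^^ c) ?_ (by simp)
        rw [him]
        refine mem_deltaSet_succ.2 ⟨Nat.xor_lt_two_pow (mem_deltaSet_succ.1 h2).1 hcm, ?_⟩
        simpa [Nat.testBit_xor] using hcon
      simp [hjm, him, this]
    · have : c.testBit m = false := by
        by_contra hcon
        obtain ⟨n', hn'⟩ := deltaSet_nonempty i
        have hlt := (lt_two_pow_of_mem_deltaSet hn').trans_le (hpow (by omega))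
        refine hsep (c ^^^ n') ?_ n' hn' (by simp)
        rw [hjm]
        refine mem_deltaSet_succ.2
          ⟨Nat.xor_lt_two_pow hcm (hlt.trans_le (Nat.pow_le_pow_right (by norm_num) (Nat.le_succ m))), ?_⟩
        simpa [Nat.testBit_xor, Nat.testBit_lt_two_pow hlt] using hcon
      simp [hjm, him, this]
    · have : c.testBit m = false := by
        by_contra hcon
        obtain ⟨n', hn'⟩ := deltaSet_nonempty j
        have hlt := (lt_two_pow_of_mem_deltaSet hn').trans_le (hpow (by omega))
        refine hsep n' hn' (n' ^^^ c) ?_ (by simp)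
        rw [him]
        refine mem_deltaSet_succ.2
          ⟨Nat.xor_lt_two_pow (hlt.trans_le (Nat.pow_le_pow_right (by norm_num) (Nat.le_succ m))) hcm, ?_⟩
        simpa [Nat.testBit_xor, Nat.testBit_lt_two_pow hlt] using hcon
      simp [hjm, him, this]
    · simp [hjm, him, hsz (by omega)]

/-- The flip of the `i`-th (from `0`) of the `K + 1` binary digits after the point of
`n / 2 ^ (K + 1)`. -/
def digitFlip (K i : ℕ) (n : Fin (2 ^ (K + 1))) : Fin (2 ^ (K + 1)) :=
  ⟨n ^^^ 2 ^ (K - i),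
    Nat.xor_lt_two_pow n.2 (Nat.pow_lt_pow_right (by norm_num) (by omega))⟩

theorem digitFlip_involutive (K i : ℕ) : Function.Involutive (digitFlip K i) := fun n => by
  ext; simp [digitFlip]

theorem digitFlip_div_of_le {K i k : ℕ} (hki : k ≤ i) (hi : i < K + 1) (n : Fin (2 ^ (K + 1))) :
    (digitFlip K i n : ℕ) / 2 ^ (K + 1 - k) = n / 2 ^ (K + 1 - k) := by
  simp only [digitFlip, Nat.xor_div_two_pow]
  rw [Nat.div_eq_of_lt (a := 2 ^ (K - i))
    (Nat.pow_lt_pow_right (by norm_num) (by omega)), Nat.xor_zero]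

theorem digitFlip_div_self {K k : ℕ} (n : Fin (2 ^ (K + 1))) :
    (digitFlip K k n : ℕ) / 2 ^ (K - k) = n / 2 ^ (K - k) ^^^ 1 := by
  simp only [digitFlip, Nat.xor_div_two_pow]
  rw [Nat.div_self (by positivity)]

/-- The value of `w_a` on the interior of the dyadic interval of order `K + 1` with index `n`. -/
def walshDigit (K a n : ℕ) : ℝ :=
  ∏ k ∈ Finset.range (a + 1), if a.testBit k then flipSign n (K - k) else 1

theorem walshDigit_sq (K a n : ℕ) : walshDigit K a n ^ 2 = 1 := by
  rw [walshDigit, ← Finset.prod_pow]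
  refine Finset.prod_eq_one fun k _ => ?_
  unfold flipSign
  split_ifs <;> norm_num

theorem lt_of_testBit {K a k : ℕ} (ha : a < 2 ^ K) (hk : a.testBit k) : k < K := by
  by_contra h
  have h1 := Nat.ge_two_pow_of_testBit hk
  have h2 : 2 ^ K ≤ 2 ^ k := Nat.pow_le_pow_right (by norm_num) (not_lt.1 h)
  omega

theorem walshDigit_digitFlip {K a i : ℕ} (ha : a < 2 ^ (K + 1)) (hi : i < K + 1)
    (n : Fin (2 ^ (K + 1))) :
    walshDigit K a (digitFlip K i n) = flipSign a i * walshDigit K a n := by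
  have hsign : flipSign a i =
      ∏ k ∈ Finset.range (a + 1), if i = k then flipSign a i else 1 := by
    rw [Finset.prod_ite_eq]
    split_ifs with h
    · rfl
    · rw [flipSign, if_neg]
      intro hbit
      have h1 := Nat.ge_two_pow_of_testBit hbit
      have h2 : i < 2 ^ i := Nat.lt_two_pow_self
      exact h (Finset.mem_range.2 (by omega))
  rw [hsign, walshDigit, walshDigit, ← Finset.prod_mul_distrib]
  refine Finset.prod_congr rfl fun k _ => ?_
  by_cases hk : a.testBit k
  · have hkK := lt_of_testBit ha hk
    simp only [hk, if_true, digitFlip, flipSign, Nat.testBit_xor, Nat.testBit_two_pow]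
    by_cases hik : i = k
    · subst hik
      simp only [hk, if_true]
      cases (n : ℕ).testBit (K - i) <;> simp
    · have : K - i ≠ K - k := by omega
      simp [hik, this]
  · by_cases hik : i = k
    · subst hik; simp [hk, flipSign]
    · simp [hk, hik]

theorem mem_dyadicI {k m : ℕ} {x : ℝ} :
    x ∈ dyadicI k m ↔ (m : ℝ) ≤ x * 2 ^ k ∧ x * 2 ^ k < m + 1 := by
  have : (0 : ℝ) < 2 ^ k := by positivity
  rw [dyadicI, Set.mem_Ico, div_le_iff₀ this, lt_div_iff₀ this]

theorem dyadicI_eq_preimage (k m : ℕ) :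
    dyadicI k m = (fun x : ℝ => ⌊x * 2 ^ k⌋) ⁻¹' {(m : ℤ)} := by
  ext x
  simp [mem_dyadicI, Int.floor_eq_iff]

theorem dyadicI_subset {k m : ℕ} (hm : m < 2 ^ k) : dyadicI k m ⊆ Set.Ico 0 1 := by
  intro x hx
  obtain ⟨h1, h2⟩ := mem_dyadicI.1 hx
  have hp : (0 : ℝ) < 2 ^ k := by positivity
  have hm' : (m : ℝ) + 1 ≤ 2 ^ k := by exact_mod_cast hm
  have h0 : (0 : ℝ) ≤ m := by positivity
  constructor
  · by_contra h; nlinarith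
  · by_contra h; nlinarith

theorem mem_dyadicI_div {k d n : ℕ} {x : ℝ} (hx : x ∈ dyadicI (k + d) n) :
    x ∈ dyadicI k (n / 2 ^ d) := by
  rw [mem_dyadicI] at *
  obtain ⟨h1, h2⟩ := hx
  have hd : (0 : ℝ) < 2 ^ d := by positivity
  rw [pow_add, ← mul_assoc] at h1 h2
  have h3 : ((n / 2 ^ d : ℕ) : ℝ) * 2 ^ d ≤ n := by exact_mod_cast Nat.div_mul_le_self n (2 ^ d)
  have h4 : (n : ℝ) + 1 ≤ ((n / 2 ^ d : ℕ) + 1) * 2 ^ d := by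
    have : n + 1 ≤ (n / 2 ^ d + 1) * 2 ^ d := by
      have h5 := Nat.lt_div_mul_add (a := n) (b := 2 ^ d) (by positivity)
      rw [add_mul, one_mul]
      exact h5
    exact_mod_cast this
  exact ⟨le_of_mul_le_mul_right (h3.trans h1) hd, lt_of_mul_lt_mul_right (h2.trans_le h4) hd.le⟩

theorem dyadicI_union (k m : ℕ) :
    dyadicI k m = dyadicI (k + 1) (2 * m) ∪ dyadicI (k + 1) (2 * m + 1) := by
  ext x
  simp only [Set.mem_union, mem_dyadicI, pow_succ]
  push_cast
  constructor
  · rintro ⟨h1, h2⟩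
    rcases lt_or_ge (x * (2 ^ k * 2)) (2 * m + 1) with h | h
    · exact Or.inl ⟨by linarith, h⟩
    · exact Or.inr ⟨h, by linarith⟩
  · rintro (⟨h1, h2⟩ | ⟨h1, h2⟩) <;> constructor <;> linarith

theorem dyadicI_disjoint (k : ℕ) {m n : ℕ} (h : m ≠ n) : Disjoint (dyadicI k m) (dyadicI k n) := by
  rw [dyadicI_eq_preimage, dyadicI_eq_preimage]
  exact Disjoint.preimage _ (by simpa using h)

theorem measurableSet_dyadicI (k m : ℕ) : MeasurableSet (dyadicI k m) := measurableSet_Ico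

theorem volume_dyadicI (k m : ℕ) : volume (dyadicI k m) = ENNReal.ofReal ((2 ^ k)⁻¹) := by
  rw [dyadicI, Real.volume_Ico]
  congr 1
  field_simp
  ring

/-- The mean value of `f` over the dyadic interval of order `k` with index `m`. -/
def dyadicAvg (f : ℝ → ℝ) (k m : ℕ) : ℝ := 2 ^ k * ∫ t in dyadicI k m, f t ∂μ01

theorem dyadicAvg_eq {f : ℝ → ℝ} (hf : Integrable f μ01) (k m : ℕ) :
    dyadicAvg f (k + 1) (2 * m) + dyadicAvg f (k + 1) (2 * m + 1) = 2 * dyadicAvg f k m := by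
  rw [dyadicAvg, dyadicAvg, dyadicAvg, dyadicI_union k m,
    setIntegral_union (dyadicI_disjoint _ (by omega)) (measurableSet_dyadicI _ _)
      hf.integrableOn hf.integrableOn]
  ring

theorem dyadicAvg_add_xor {f : ℝ → ℝ} (hf : Integrable f μ01) (k q : ℕ) :
    dyadicAvg f (k + 1) q + dyadicAvg f (k + 1) (q ^^^ 1) = 2 * dyadicAvg f k (q / 2) := by
  rw [← dyadicAvg_eq hf]
  rcases Nat.even_or_odd' q with ⟨m, rfl | rfl⟩
  · rw [Nat.xor_one_of_even (by simp)]
    simp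
  · rw [Nat.xor_one_of_odd (by simp), add_comm]
    simp [show (2 * m + 1) / 2 = m by omega]

theorem isDyadicMartingale_dyadicAvg {f : ℝ → ℝ} (hf : Integrable f μ01) (K : ℕ) :
    IsDyadicMartingale (digitFlip K) (K + 1)
      (fun k n => dyadicAvg f k (n / 2 ^ (K + 1 - k))) where
  invariant k i n hki hi := by rw [digitFlip_div_of_le hki hi]
  average k n hk := by
    rw [show K + 1 - (k + 1) = K - k by omega, digitFlip_div_self, dyadicAvg_add_xor hf,
      Nat.div_div_eq_div_mul, ← pow_succ, show K - k + 1 = K + 1 - k by omega]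

instance : IsProbabilityMeasure μ01 := ⟨by simp [μ01]⟩

theorem dyadicSigma_le (k : ℕ) : dyadicSigma k ≤ (inferInstance : MeasurableSpace ℝ) := by
  rw [dyadicSigma, ← measurable_iff_comap_le]
  exact Int.measurable_floor.comp (measurable_id.mul_const _)

theorem Ek_eq_dyadicAvg {f : ℝ → ℝ} (hf : Integrable f μ01) {k m : ℕ} (hm : m < 2 ^ k) {x : ℝ}
    (hx : x ∈ dyadicI k m) : Ek k f x = dyadicAvg f k m := by
  have hconst : ∀ y ∈ dyadicI k m, Ek k f y = Ek k f x := by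
    have h : StronglyMeasurable[dyadicSigma k] (Ek k f) := stronglyMeasurable_condExp
    intro y hy
    rw [dyadicI_eq_preimage] at hx hy
    exact h.factorsThrough (hy.trans hx.symm)
  have hint : ∫ y in dyadicI k m, Ek k f y ∂μ01 = ∫ y in dyadicI k m, f y ∂μ01 :=
    setIntegral_condExp (dyadicSigma_le k) hf
      ⟨{(m : ℤ)}, trivial, (dyadicI_eq_preimage k m).symm⟩
  rw [dyadicAvg, ← hint, setIntegral_congr_fun (measurableSet_dyadicI k m) hconst,
    setIntegral_const]
  have hvol : μ01.real (dyadicI k m) = (2 ^ k)⁻¹ := by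
    rw [measureReal_def, μ01, Measure.restrict_apply (measurableSet_dyadicI k m),
      Set.inter_eq_left.2 (dyadicI_subset hm), volume_dyadicI, ENNReal.toReal_ofReal (by positivity)]
  rw [hvol, smul_eq_mul, ← mul_assoc, mul_inv_cancel₀ (by positivity), one_mul]

theorem dyadicAvg_zero (f : ℝ → ℝ) : dyadicAvg f 0 0 = ∫ x in Set.Ico (0:ℝ) 1, f x := by
  simp [dyadicAvg, dyadicI, μ01]

theorem Dk_eq_martingaleDiff {f : ℝ → ℝ} (hf : Integrable f μ01) {K j : ℕ} (hj : j ≤ K + 1)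
    (n : Fin (2 ^ (K + 1))) {x : ℝ} (hx : x ∈ dyadicI (K + 1) n) :
    Dk j f x = martingaleDiff
      (fun k (n : Fin (2 ^ (K + 1))) => dyadicAvg f k (n / 2 ^ (K + 1 - k))) j n := by
  have hE : ∀ k ≤ K + 1, Ek k f x = dyadicAvg f k (n / 2 ^ (K + 1 - k)) := fun k hk => by
    obtain ⟨d, hd⟩ := Nat.exists_eq_add_of_le hk
    rw [show K + 1 - k = d by omega]
    refine Ek_eq_dyadicAvg hf ?_ (mem_dyadicI_div (by rwa [← hd]))
    rw [Nat.div_lt_iff_lt_mul (by positivity), ← pow_add, ← hd]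
    exact n.2
  cases j with
  | zero =>
    simp [Dk, martingaleDiff, Nat.div_eq_of_lt n.2, dyadicAvg_zero]
  | succ j =>
    simp only [Dk, martingaleDiff, Nat.succ_ne_zero, if_false, Pi.sub_apply]
    rw [hE _ hj, Nat.add_sub_cancel, hE j (by omega)]

theorem rademacher_eq_flipSign {k d n : ℕ} {x : ℝ} (hx : x ∈ dyadicI (k + d) n)
    (hdy : ∀ p q : ℕ, x ≠ p / 2 ^ q) : rademacher k x = flipSign n d := by
  obtain ⟨h1, h2⟩ := mem_dyadicI.1 (mem_dyadicI_div hx)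
  set q := n / 2 ^ d
  have h1' : (q : ℝ) < x * 2 ^ k := lt_of_le_of_ne h1 fun h => hdy q k (by rw [h]; field_simp)
  have hsin : Real.sin (2 ^ k * π * x) = (-1) ^ q * Real.sin ((x * 2 ^ k - q) * π) := by
    rw [← Real.sin_add_nat_mul_pi]; congr 1; ring
  have hpos : 0 < Real.sin ((x * 2 ^ k - q) * π) :=
    Real.sin_pos_of_pos_of_lt_pi (mul_pos (by linarith) pi_pos) (by nlinarith [pi_pos])
  rw [rademacher, hsin, flipSign, Nat.testBit_eq_decide_div_mod_eq]
  rcases Nat.even_or_odd q with h | h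
  · have h' : ¬ n / 2 ^ d % 2 = 1 := by rw [Nat.even_iff.1 h]; norm_num
    simp [h.neg_one_pow, Real.sign_of_pos hpos, h']
  · have h' : n / 2 ^ d % 2 = 1 := Nat.odd_iff.1 h
    simp [h.neg_one_pow, Real.sign_of_neg (neg_neg_of_pos hpos), h']

theorem walsh_eq_walshDigit {K a n : ℕ} (ha : a < 2 ^ (K + 1)) {x : ℝ}
    (hx : x ∈ dyadicI (K + 1) n) (hdy : ∀ p q : ℕ, x ≠ p / 2 ^ q) :
    walsh a x = walshDigit K a n := by
  refine Finset.prod_congr rfl fun k _ => ?_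
  split_ifs with hk
  · have := lt_of_testBit ha hk
    exact rademacher_eq_flipSign (by rwa [show k + 1 + (K - k) = K + 1 by omega]) hdy
  · rfl

theorem integrable_sqrt_sum_sq {N : ℕ} {g : Fin N → ℝ → ℝ} (hg : ∀ s, Integrable (g s) μ01) :
    Integrable (fun x => √(∑ s, g s x ^ 2)) μ01 := by
  refine (integrable_finsetSum Finset.univ fun s _ => (hg s).norm).mono' ?_ (.of_forall fun x => ?_)
  · refine Real.continuous_sqrt.comp_aestronglyMeasurable ?_
    exact Finset.aestronglyMeasurable_fun_sum _ fun s _ => (hg s).aestronglyMeasurable.pow 2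
  · rw [Real.norm_of_nonneg (Real.sqrt_nonneg _), Real.sqrt_le_left (by positivity)]
    simpa using Finset.sum_sq_le_sq_sum_of_nonneg (s := Finset.univ) (f := fun s => ‖g s x‖)
      fun s _ => norm_nonneg _

theorem sum_dyadicAvg_sq_le {N : ℕ} {g : Fin N → ℝ → ℝ} (hg : ∀ s, Integrable (g s) μ01)
    (k m : ℕ) :
    ∑ s, dyadicAvg (g s) k m ^ 2 ≤ dyadicAvg (fun x => √(∑ s, g s x ^ 2)) k m ^ 2 := by
  set G : ℝ → EuclideanSpace ℝ (Fin N) := fun x => WithLp.toLp 2 fun s => g s x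
  have hnorm : ∀ x, ‖G x‖ = √(∑ s, g s x ^ 2) := fun x => by
    simp [G, EuclideanSpace.norm_eq]
  have hG : Integrable G (μ01.restrict (dyadicI k m)) :=
    (EuclideanSpace.equiv (Fin N) ℝ).symm.toContinuousLinearMap.integrable_comp
      (Integrable.of_eval fun s => (hg s).integrableOn)
  have hcoord : ∀ s, (∫ t in dyadicI k m, G t ∂μ01) s = ∫ t in dyadicI k m, g s t ∂μ01 :=
    fun s => ((EuclideanSpace.proj s : EuclideanSpace ℝ (Fin N) →L[ℝ] ℝ).integral_comp_comm
      hG).symm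
  have h := norm_integral_le_integral_norm (μ := μ01.restrict (dyadicI k m)) G
  simp only [hnorm, EuclideanSpace.norm_eq, hcoord, Real.norm_eq_abs, sq_abs] at h
  simp only [dyadicAvg, mul_pow, ← Finset.mul_sum]
  gcongr
  exact (Real.sqrt_le_iff.1 h).2

end

/-- weak type `(1,1)` of `T*`: there is an absolute constant `C` such
that if the sets `a_s ∔ δ_j` (`j ∈ Θ_s ∪ {0}`) are pairwise disjoint and
`T*g = Σ_s w_{a_s} Σ_{j ∈ Θ_s ∪ {0}} Δ_j g_s`, then for every `λ > 0`,
`|{x : |T*g(x)| > λ}| ≤ C λ⁻¹ ∫_0^1 (Σ_s |g_s|²)^{1/2}`. -/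
theorem stmt16 :
    ∃ C : ℝ, 0 < C ∧
      ∀ (N : ℕ) (a : Fin N → ℕ) (Θ : Fin N → Finset ℕ), (∀ s, 0 ∉ Θ s) →
        (∀ s s' j j', j ∈ insert 0 (Θ s) → j' ∈ insert 0 (Θ s') → (s, j) ≠ (s', j') →
          Disjoint ((fun n => a s ^^^ n) '' deltaSet j)
            ((fun n => a s' ^^^ n) '' deltaSet j')) →
        ∀ g : Fin N → ℝ → ℝ, (∀ s, MeasureTheory.Integrable (g s) μ01) →
          ∀ lam : ℝ, 0 < lam →
            MeasureTheory.volume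
                {x ∈ Set.Ico (0:ℝ) 1 |
                  lam < |∑ s, walsh (a s) x * ∑ j ∈ insert 0 (Θ s), Dk j (g s) x|}
              ≤ ENNReal.ofReal
                  (C * lam⁻¹ * ∫ x in Set.Ico (0:ℝ) 1, Real.sqrt (∑ s, g s x ^ 2)) := by
  classical
  refine ⟨3, by norm_num, fun N a Θ _ hdisj g hg lam hlam => ?_⟩
  obtain ⟨K, hK⟩ : ∃ K, ∀ s, a s ≤ K ∧ ∀ j ∈ insert 0 (Θ s), j ≤ K :=
    ⟨Finset.univ.sup fun s => max (a s) ((insert 0 (Θ s)).sup id), fun s =>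
      ⟨(le_max_left _ _).trans (Finset.le_sup (f := fun s => max (a s) ((insert 0 (Θ s)).sup id))
          (Finset.mem_univ s)),
        fun j hj => (Finset.le_sup (f := id) hj).trans ((le_max_right _ _).trans
          (Finset.le_sup (f := fun s => max (a s) ((insert 0 (Θ s)).sup id))
            (Finset.mem_univ s)))⟩⟩
  have ha : ∀ s, a s < 2 ^ (K + 1) := fun s =>
    ((hK s).1.trans (Nat.le_succ K)).trans_lt Nat.lt_two_pow_self
  have hΘ : ∀ s, ∀ j ∈ insert 0 (Θ s), j ≤ K + 1 := fun s j hj =>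
    ((hK s).2 j hj).trans (Nat.le_succ K)
  set h : ℝ → ℝ := fun x => √(∑ s, g s x ^ 2)
  have hh : Integrable h μ01 := integrable_sqrt_sum_sq hg
  set F : Fin N → ℕ → Fin (2 ^ (K + 1)) → ℝ := fun s k n =>
    dyadicAvg (g s) k (n / 2 ^ (K + 1 - k))
  set M : ℕ → Fin (2 ^ (K + 1)) → ℝ := fun k n => dyadicAvg h k (n / 2 ^ (K + 1 - k))
  set W : Fin N → Fin (2 ^ (K + 1)) → ℝ := fun s n => walshDigit K (a s) n
  set B := Finset.univ.filter fun n : Fin (2 ^ (K + 1)) =>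
    lam < |∑ s, W s n * ∑ j ∈ insert 0 (Θ s), martingaleDiff (F s) j n|
  have hcard : (B.card : ℝ) * lam ≤ 3 * ∑ n, M 0 n :=
    card_mul_le_of_orthogonal (ε := fun s => flipSign (a s)) (digitFlip_involutive K)
      (fun s => isDyadicMartingale_dyadicAvg (hg s) K) (isDyadicMartingale_dyadicAvg hh K)
      (fun k n => mul_nonneg (by positivity) (integral_nonneg fun x => Real.sqrt_nonneg _))
      (fun k n => sum_dyadicAvg_sq_le hg k _) (fun s n => (walshDigit_sq K (a s) n).le)
      (fun s i n hi => walshDigit_digitFlip (ha s) hi n) hΘ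
      (fun s s' j j' hj hj' hne => exists_odd_flip (hΘ s j hj) (hΘ s' j' hj') (ha s) (ha s')
        (hdisj s s' j j' hj hj' hne)) hlam
  have hM0 : ∀ n, M 0 n = ∫ x in Set.Ico (0:ℝ) 1, h x := fun n => by
    simp only [M, Nat.sub_zero, Nat.div_eq_of_lt n.2, dyadicAvg_zero]
  simp only [hM0, Finset.sum_const, Finset.card_univ, Fintype.card_fin, nsmul_eq_mul,
    Nat.cast_pow, Nat.cast_ofNat] at hcard
  set R : Set ℝ := Set.range fun p : ℕ × ℕ => (p.1 : ℝ) / 2 ^ p.2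
  have hR : volume R = 0 := (Set.countable_range _).measure_zero _
  have hsub : {x ∈ Set.Ico (0:ℝ) 1 |
      lam < |∑ s, walsh (a s) x * ∑ j ∈ insert 0 (Θ s), Dk j (g s) x|} ⊆
      (⋃ n ∈ B, dyadicI (K + 1) (n : ℕ)) ∪ R := by
    rintro x ⟨⟨hx0, hx1⟩, hx⟩
    by_cases hxR : x ∈ R
    · exact Or.inr hxR
    have hdy : ∀ p q : ℕ, x ≠ p / 2 ^ q := fun p q hpq => hxR ⟨(p, q), hpq.symm⟩
    have hp : (0 : ℝ) < 2 ^ (K + 1) := by positivity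
    have hlt : ⌊x * 2 ^ (K + 1)⌋₊ < 2 ^ (K + 1) := by
      rw [Nat.floor_lt (by positivity)]
      push_cast
      nlinarith
    obtain ⟨n, hn⟩ : ∃ n : Fin (2 ^ (K + 1)), x ∈ dyadicI (K + 1) n :=
      ⟨⟨_, hlt⟩, mem_dyadicI.2 ⟨Nat.floor_le (by positivity), Nat.lt_floor_add_one _⟩⟩
    refine Or.inl (Set.mem_iUnion₂.2 ⟨n, Finset.mem_filter.2 ⟨Finset.mem_univ n, ?_⟩, hn⟩)
    refine hx.trans_eq (congrArg _ (Finset.sum_congr rfl fun s _ => ?_))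
    rw [walsh_eq_walshDigit (ha s) hn hdy]
    exact congrArg _ (Finset.sum_congr rfl fun j hj =>
      Dk_eq_martingaleDiff (hg s) (hΘ s j hj) n hn)
  calc _ ≤ volume ((⋃ n ∈ B, dyadicI (K + 1) (n : ℕ)) ∪ R) := measure_mono hsub
    _ ≤ volume (⋃ n ∈ B, dyadicI (K + 1) (n : ℕ)) + volume R := measure_union_le _ _
    _ ≤ ∑ n ∈ B, volume (dyadicI (K + 1) (n : ℕ)) := by
        rw [hR, add_zero]
        exact measure_biUnion_finset_le _ _
    _ = ENNReal.ofReal (B.card * (2 ^ (K + 1))⁻¹) := by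
        simp only [volume_dyadicI, Finset.sum_const, nsmul_eq_mul]
        rw [ENNReal.ofReal_mul (by positivity), ENNReal.ofReal_natCast]
    _ ≤ _ := by
        refine ENNReal.ofReal_le_ofReal ?_
        have hp : (0 : ℝ) < 2 ^ (K + 1) := by positivity
        rw [← div_eq_mul_inv, div_le_iff₀ hp]
        calc (B.card : ℝ) = B.card * lam * lam⁻¹ := by field_simp
          _ ≤ (3 * (2 ^ (K + 1) * ∫ x in Set.Ico (0:ℝ) 1, h x)) * lam⁻¹ := by gcongr
          _ = _ := by ring
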